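/- Let ε > 0 and let p_0, p_1 be real numbers with p_0 > 0, p_1 > 0, p_0 + p_1 = 1, and p_1 < p_0. Define F(p, q) = (pq − (1−p)(1−q)) / ((p_0(1−p) + p_1 q)(p_0 p + p_1(1−q))) and let S_ε = {(p, q) : 1/2 ≤ p ≤ 1, 1/2 ≤ q ≤ 1, p ≤ e^ε(1−q), q ≤ e^ε(1−p), and (p = e^ε(1−q) or q = e^ε(1−p))}. Then (1/2, 1 − e^{−ε}/2) ∈ S_ε and for every (p, q) ∈ S_ε, F(1/2, 1 − e^{−ε}/2) ≤ F(p, q). -/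

import Mathlib

/-- The ratio `Δ'(D_M)/Δ'(D)` of perturbed to original data unfairness for the binary
mechanism with truthful-reporting probabilities `p` (for `A = 0`) and `q` (for `A = 1`),
where `p₀ = Pr(A = 0)` and `p₁ = Pr(A = 1)`. -/
noncomputable def F (p₀ p₁ p q : ℝ) : ℝ :=
  (p * q - (1 - p) * (1 - q)) /
    ((p₀ * (1 - p) + p₁ * q) * (p₀ * p + p₁ * (1 - q)))

/-- The parameter pairs of `ε`-LDP binary mechanisms with non-trivial utility whose
privacy level is exactly `ε` (at least one LDP constraint is tight). -/
def Sset (ε : ℝ) : Set (ℝ × ℝ) :=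
  {pq : ℝ × ℝ |
    1 / 2 ≤ pq.1 ∧ pq.1 ≤ 1 ∧ 1 / 2 ≤ pq.2 ∧ pq.2 ≤ 1 ∧
    pq.1 ≤ Real.exp ε * (1 - pq.2) ∧ pq.2 ≤ Real.exp ε * (1 - pq.1) ∧
    (pq.1 = Real.exp ε * (1 - pq.2) ∨ pq.2 = Real.exp ε * (1 - pq.1))}

/-- On the tight constraint `q = 1 - p * t`, where `t = exp (-ε)`, the numerator of `F` and one
factor of its denominator are both proportional to `p`. -/
theorem F_one_sub_mul {p₀ p₁ p : ℝ} (t : ℝ) (hsum : p₀ + p₁ = 1) (hp : p ≠ 0) :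
    F p₀ p₁ p (1 - p * t) = (1 - t) / ((p₀ + p₁ * t) * (1 - p * (p₀ + p₁ * t))) := by
  obtain rfl : p₀ = 1 - p₁ := by linarith
  unfold F
  rw [← mul_div_mul_left (1 - t) _ hp]
  congr 1 <;> ring

/-- Exchanging the roles of the two groups leaves `F` unchanged. -/
theorem F_swap (p₀ p₁ p q : ℝ) : F p₀ p₁ p q = F p₁ p₀ q p := by
  unfold F
  congr 1 <;> ring

/-- Theorem 1 (case `p₁ < p₀`): the optimal `ε`-LDP mechanism minimizing the data
unfairness ratio is `(p*, q*) = (1/2, 1 − e^{−ε}/2)`. -/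
theorem optimal_binary_mechanism_p1_lt_p0
    (ε p₀ p₁ : ℝ) (hε : 0 < ε)
    (h₀ : 0 < p₀) (h₁ : 0 < p₁) (hsum : p₀ + p₁ = 1) (hlt : p₁ < p₀) :
    (1 / 2, 1 - Real.exp (-ε) / 2) ∈ Sset ε ∧
    ∀ pq ∈ Sset ε, F p₀ p₁ (1 / 2) (1 - Real.exp (-ε) / 2) ≤ F p₀ p₁ pq.1 pq.2 := by
  set t := Real.exp (-ε) with ht
  have hEt : Real.exp ε * t = 1 := by rw [ht, ← Real.exp_add]; simp
  have ht0 : 0 < t := Real.exp_pos _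
  have ht1 : t < 1 := by rw [ht, Real.exp_lt_one_iff]; linarith
  have eq_one_sub_mul {x y : ℝ} (h : x = Real.exp ε * (1 - y)) : y = 1 - x * t := by
    linear_combination t * h + (1 - y) * hEt
  have hE : 2 - t ≤ Real.exp ε := by nlinarith [sq_nonneg (1 - t)]
  refine ⟨⟨le_rfl, by norm_num, ?_, ?_, ?_, ?_, Or.inl ?_⟩, ?_⟩
  · dsimp only; linarith
  · dsimp only; linarith
  · dsimp only; linarith
  · dsimp only; linarith
  · dsimp only; linarith
  rintro ⟨p, q⟩ ⟨hp, hp1, hq, hq1, -, -, h⟩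
  dsimp only at *
  have hc0 : 0 < p₀ + p₁ * t := by positivity
  have hd0 : 0 < p₁ + p₀ * t := by positivity
  have hc1 : p₀ + p₁ * t < 1 := by nlinarith
  have hd1 : p₁ + p₀ * t < 1 := by nlinarith
  have hdc : p₁ + p₀ * t ≤ p₀ + p₁ * t := by nlinarith
  rw [show 1 - t / 2 = 1 - 1 / 2 * t by ring, F_one_sub_mul t hsum (by norm_num)]
  rcases h with h | h
  · rw [eq_one_sub_mul h, F_one_sub_mul t hsum (by linarith)]
    generalize p₀ + p₁ * t = c at *
    have : 0 < 1 - p * c := by nlinarith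
    gcongr
  · rw [eq_one_sub_mul h, F_swap, F_one_sub_mul t (by linarith) (by linarith)]
    generalize p₀ + p₁ * t = c at *
    generalize p₁ + p₀ * t = d at *
    have : 0 < 1 - q * d := by nlinarith
    have hd : d * (1 - q * d) ≤ d * (1 - 1 / 2 * d) := by gcongr
    have hdc' : d * (1 - 1 / 2 * d) ≤ c * (1 - 1 / 2 * c) := by nlinarith
    exact div_le_div_of_nonneg_left (by linarith) (by positivity) (hd.trans hdc')
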